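/- arXiv:1107.3205 — 2 statements merged into one kernel-verified Lean document; each statement's English description precedes it below -/
import Mathlib

section
/- Theorem 2.3, separant part. Let f ∈ A be differentially homogeneous of degree m, and let i ∈ Fin (n+1) and o ∈ ℕ be such that no variable X(i,k) with k > o occurs in f (this holds in particular when y_i^{(o)} is the leader of f with respect to a ranking). Then pderiv (X(i,o)) f is differentially homogeneous of degree m − 1. -/
open MvPolynomial

/-- The embedding `ι : F{y_0,…,y_n} → F{t; y_0,…,y_n}`, `X(j,k) ↦ X(Sum.inl j, k)`. -/
noncomputable def iotaMap (F : Type*) [Field F] (n : ℕ) :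
    MvPolynomial (Fin (n + 1) × ℕ) F →ₐ[F] MvPolynomial ((Fin (n + 1) ⊕ Unit) × ℕ) F :=
  aeval fun p => X (Sum.inl p.1, p.2)

/-- The substitution `φ : F{y_0,…,y_n} → F{t; y_0,…,y_n}` sending `X(j,k)` to the expansion
of the `k`-th derivative of `t·y_j`, namely `Σ_{s=0}^{k} (k choose s)·T_s·X(Sum.inl j, k−s)`. -/
noncomputable def phiMap (F : Type*) [Field F] (n : ℕ) :
    MvPolynomial (Fin (n + 1) × ℕ) F →ₐ[F] MvPolynomial ((Fin (n + 1) ⊕ Unit) × ℕ) F :=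
  aeval fun p => ∑ s ∈ Finset.range (p.2 + 1),
    (p.2.choose s : MvPolynomial ((Fin (n + 1) ⊕ Unit) × ℕ) F) *
      X (Sum.inr (), s) * X (Sum.inl p.1, p.2 - s)

/-- `f` is differentially homogeneous of degree `m` : `φ(f) = T_0^m · ι(f)`. -/
def DiffHomog (F : Type*) [Field F] (n m : ℕ)
    (f : MvPolynomial (Fin (n + 1) × ℕ) F) : Prop :=
  phiMap F n f = X (Sum.inr (), 0) ^ m * iotaMap F n f

theorem iotaMap_eq_rename (F : Type*) [Field F] (n : ℕ) :
    iotaMap F n = rename (fun p => (Sum.inl p.1, p.2)) := by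
  ext1 p
  simp [iotaMap]

theorem pderiv_iotaMap (F : Type*) [Field F] (n : ℕ) (i : Fin (n + 1)) (o : ℕ)
    (f : MvPolynomial (Fin (n + 1) × ℕ) F) :
    pderiv (Sum.inl i, o) (iotaMap F n f) = iotaMap F n (pderiv (i, o) f) := by
  have hinj : Function.Injective
      (fun p : Fin (n + 1) × ℕ => ((Sum.inl p.1, p.2) : (Fin (n + 1) ⊕ Unit) × ℕ)) := by
    rintro ⟨a, b⟩ ⟨c, d⟩ h
    simpa using h
  simpa only [iotaMap_eq_rename] using pderiv_rename hinj (i, o) f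

theorem phiMap_X (F : Type*) [Field F] (n : ℕ) (p : Fin (n + 1) × ℕ) :
    phiMap F n (X p) = ∑ s ∈ Finset.range (p.2 + 1),
      (p.2.choose s : MvPolynomial ((Fin (n + 1) ⊕ Unit) × ℕ) F) *
        X (Sum.inr (), s) * X (Sum.inl p.1, p.2 - s) :=
  aeval_X _ _

theorem pderiv_phiMap_X (F : Type*) [Field F] (n : ℕ) (i : Fin (n + 1)) (o : ℕ)
    (p : Fin (n + 1) × ℕ) (hp : p.1 = i → p.2 ≤ o) :
    pderiv (Sum.inl i, o) (phiMap F n (X p)) =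
      X (Sum.inr (), 0) * phiMap F n (pderiv (i, o) (X p)) := by
  obtain ⟨j, k⟩ := p
  rw [phiMap_X, map_sum, Finset.sum_range_succ']
  have htail : ∀ s ∈ Finset.range k, pderiv (Sum.inl i, o)
      ((k.choose (s + 1) : MvPolynomial ((Fin (n + 1) ⊕ Unit) × ℕ) F) *
        X (Sum.inr (), s + 1) * X (Sum.inl j, k - (s + 1))) = 0 := by
    intro s hs
    have hne : ((Sum.inl j, k - (s + 1)) : (Fin (n + 1) ⊕ Unit) × ℕ) ≠ (Sum.inl i, o) := by
      simp only [ne_eq, Prod.mk.injEq, Sum.inl.injEq, not_and]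
      intro hj
      have := hp hj
      have := Finset.mem_range.mp hs
      simp only at *
      omega
    simp [Derivation.leibniz, pderiv_X_of_ne hne, pderiv_X]
  rw [Finset.sum_eq_zero htail]
  by_cases h : (j, k) = (i, o)
  · obtain ⟨rfl, rfl⟩ := Prod.mk.inj h
    simp [Derivation.leibniz, pderiv_X]
  · have h' : ((Sum.inl j, k) : (Fin (n + 1) ⊕ Unit) × ℕ) ≠ (Sum.inl i, o) := by
      simpa using h
    simp [Derivation.leibniz, pderiv_X_of_ne h, pderiv_X_of_ne h', pderiv_X]

/-- The chain rule for `phiMap` at a highest derivative: only the variable `X (i, o)` itself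
contributes. -/
theorem pderiv_phiMap (F : Type*) [Field F] (n : ℕ) (i : Fin (n + 1)) (o : ℕ)
    (f : MvPolynomial (Fin (n + 1) × ℕ) F) (hord : ∀ k : ℕ, (i, k) ∈ f.vars → k ≤ o) :
    pderiv (Sum.inl i, o) (phiMap F n f) =
      X (Sum.inr (), 0) * phiMap F n (pderiv (i, o) f) := by
  have hf : f ∈ supported F {p : Fin (n + 1) × ℕ | p.1 = i → p.2 ≤ o} := by
    rw [mem_supported]
    rintro ⟨j, k⟩ hp rfl
    exact hord k hp
  clear hord
  rw [supported] at hf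
  induction hf using Algebra.adjoin_induction with
  | mem x hx =>
    obtain ⟨p, hp, rfl⟩ := hx
    exact pderiv_phiMap_X F n i o p hp
  | algebraMap r => simp
  | add x y _ _ hx hy => simp only [map_add, hx, hy, mul_add]
  | mul x y _ _ hx hy =>
    simp only [map_mul, map_add, Derivation.leibniz, smul_eq_mul, hx, hy]
    ring

/-- Setting `t = 0`, as a retraction of `iotaMap`. -/
theorem eq_zero_of_X_mul_eq_iotaMap (F : Type*) [Field F] (n : ℕ)
    (f : MvPolynomial (Fin (n + 1) × ℕ) F) (g : MvPolynomial ((Fin (n + 1) ⊕ Unit) × ℕ) F)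
    (h : X (Sum.inr (), 0) * g = iotaMap F n f) : f = 0 := by
  let r : MvPolynomial ((Fin (n + 1) ⊕ Unit) × ℕ) F →ₐ[F] MvPolynomial (Fin (n + 1) × ℕ) F :=
    aeval fun q => Sum.elim (fun j => X (j, q.2)) (fun _ => 0) q.1
  have hr : r.comp (iotaMap F n) = AlgHom.id F _ := by
    ext1 p
    simp [r, iotaMap]
  calc f = r (iotaMap F n f) := (DFunLike.congr_fun hr f).symm
    _ = 0 := by rw [← h, map_mul]; simp [r]

/-- **Theorem 2.3, separant part.** If `f` is differentially homogeneous of degree `m` and no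
variable `X(i,k)` with `k > o` occurs in `f`, then `∂f/∂y_i^{(o)}` is differentially
homogeneous of degree `m − 1`. -/
theorem stmt_1 (F : Type*) [Field F] [CharZero F] (n m : ℕ) (i : Fin (n + 1)) (o : ℕ)
    (f : MvPolynomial (Fin (n + 1) × ℕ) F)
    (hhom : DiffHomog F n m f)
    (hord : ∀ k : ℕ, (i, k) ∈ f.vars → k ≤ o) :
    DiffHomog F n (m - 1) (pderiv (i, o) f) := by
  have key : X (Sum.inr (), 0) * phiMap F n (pderiv (i, o) f) =
      X (Sum.inr (), 0) ^ m * iotaMap F n (pderiv (i, o) f) := by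
    rw [← pderiv_phiMap F n i o f hord, hhom, ← pderiv_iotaMap]
    simp [Derivation.leibniz, Derivation.leibniz_pow, pderiv_X]
  cases m with
  | zero =>
    rw [pow_zero, one_mul] at key
    simp [DiffHomog, eq_zero_of_X_mul_eq_iotaMap F n _ _ key]
  | succ m =>
    refine mul_left_cancel₀ (X_ne_zero _) (key.trans ?_)
    rw [Nat.add_sub_cancel]
    ring
end

section
/- (Reduction step in the proof of Theorem 5.3.) Let F[w; Y] be the ordinary polynomial ring over F in the variables w_{kj} (0 ≤ k ≤ d, 0 ≤ j ≤ n) and y_0,…,y_n, and set L_k = Σ_{j=0}^{n} w_{kj}·y_j. Let f_1,…,f_r ∈ F[y_0,…,y_n], let F_0 be a polynomial in the variables w_{kj} only, and suppose that for some index j_0 and some a ∈ ℕ, y_{j_0}^a · F_0 lies in the ideal of F[w; Y] generated by {L_0, …, L_d} ∪ {f_1,…,f_r}. Let σ(F_0) be the element of the differential polynomial ring F{y_0,…,y_n; u_0,…,u_n} obtained from F_0 by substituting w_{kj} ↦ u_j^{(k)} (the variable X(u_j, k)). Then there exists e ∈ ℕ such that y_{j_0}^e · σ(F_0) ∈ [{f_1,…,f_r}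 ∪ {P_0} ∪ {y_i·y_j′ − y_j·y_i′ : 0 ≤ i < j ≤ n}], where P_0 = Σ_{j=0}^{n} u_j·y_j and the f_i are regarded as differential polynomials in the variables X(y_j, 0). -/
open MvPolynomial

/-- The differential ideal `[S]` generated by a set `S`: the ideal generated by all `δ^k(s)`,
`s ∈ S`, `k ∈ ℕ`. -/
noncomputable def diffIdealGen {R : Type*} [CommRing R] (δ : R → R) (S : Set R) : Ideal R :=
  Ideal.span {g | ∃ s ∈ S, ∃ k : ℕ, g = δ^[k] s}

/-- The differential ideal generated by a set is closed under the derivation. -/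
theorem map_mem_diffIdealGen {R : Type*} [CommRing R] (δ : Derivation ℤ R R) {S : Set R} {x : R}
    (hx : x ∈ diffIdealGen δ S) : δ x ∈ diffIdealGen δ S := by
  unfold diffIdealGen at *
  induction hx using Submodule.span_induction with
  | mem x hx =>
    obtain ⟨s, hs, k, rfl⟩ := hx
    exact Ideal.subset_span ⟨s, hs, k + 1, (Function.iterate_succ_apply' _ _ _).symm⟩
  | zero => simp
  | add x y _ _ hx hy => simpa using add_mem hx hy
  | smul c x hx ih =>
    rw [smul_eq_mul, Derivation.leibniz, smul_eq_mul, smul_eq_mul]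
    exact add_mem (Ideal.mul_mem_left _ _ ih) (Ideal.mul_mem_right _ _ hx)

theorem subset_diffIdealGen {R : Type*} [CommRing R] (δ : R → R) (S : Set R) :
    S ⊆ diffIdealGen δ S :=
  fun s hs => Ideal.subset_span ⟨s, hs, 0, rfl⟩

/-- If an ideal closed under a derivation contains `∑ j, u j 0 * y j` and all the Wronskians
`y i * δ (y j) - y j * δ (y i)`, where `δ (u j k) = u j (k + 1)`, then it contains
`y i ^ k * ∑ j, u j k * y j`. -/
theorem pow_mul_sum_mem_of_wronskian_mem {R ι : Type*} [CommRing R] [Fintype ι]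
    (δ : Derivation ℤ R R) (I : Ideal R) (hI : ∀ x ∈ I, δ x ∈ I) (y : ι → R) (u : ι → ℕ → R)
    (hu : ∀ j k, δ (u j k) = u j (k + 1)) (hP : ∑ j, u j 0 * y j ∈ I) (i : ι)
    (hW : ∀ j, y i * δ (y j) - y j * δ (y i) ∈ I) (k : ℕ) :
    y i ^ k * ∑ j, u j k * y j ∈ I := by
  induction k with
  | zero => simpa using hP
  | succ k ih =>
    have hsum : ∑ j, u j k * (y i * δ (y j) - y j * δ (y i)) ∈ I :=
      Ideal.sum_mem _ fun j _ => Ideal.mul_mem_left _ _ (hW j)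
    have hQ : δ (∑ j, u j k * y j) = ∑ j, u j (k + 1) * y j + ∑ j, u j k * δ (y j) := by
      rw [map_sum, ← Finset.sum_add_distrib]
      refine Finset.sum_congr rfl fun j _ => ?_
      rw [Derivation.leibniz, hu, smul_eq_mul, smul_eq_mul]
      ring
    have hpow : y i * δ (y i ^ k) = k * y i ^ k * δ (y i) := by
      rw [Derivation.leibniz_pow, nsmul_eq_mul, smul_eq_mul]
      cases k with
      | zero => simp
      | succ k => rw [Nat.add_sub_cancel]; ring
    have hW' : ∑ j, u j k * (y i * δ (y j) - y j * δ (y i)) =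
        y i * ∑ j, u j k * δ (y j) - δ (y i) * ∑ j, u j k * y j := by
      rw [Finset.mul_sum, Finset.mul_sum, ← Finset.sum_sub_distrib]
      exact Finset.sum_congr rfl fun j _ => by ring
    have hδ : δ (y i ^ k * ∑ j, u j k * y j) =
        y i ^ k * (∑ j, u j (k + 1) * y j + ∑ j, u j k * δ (y j)) +
          (∑ j, u j k * y j) * δ (y i ^ k) := by
      rw [Derivation.leibniz, hQ, smul_eq_mul, smul_eq_mul]
    have key : y i ^ (k + 1) * ∑ j, u j (k + 1) * y j =
        y i * δ (y i ^ k * ∑ j, u j k * y j)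
          - (k + 1) * δ (y i) * (y i ^ k * ∑ j, u j k * y j)
          - y i ^ k * ∑ j, u j k * (y i * δ (y j) - y j * δ (y i)) := by
      rw [hδ, hW']
      linear_combination -(∑ j, u j k * y j) * hpow
    rw [key]
    exact sub_mem (sub_mem (Ideal.mul_mem_left _ _ (hI _ ih)) (Ideal.mul_mem_left _ _ ih))
      (Ideal.mul_mem_left _ _ hsum)

/-- **Reduction step in the proof of Theorem 5.3.**  If `y_{j_0}^a·F_0` lies in the ideal of
the ordinary polynomial ring `F[w;Y]` generated by the generic linear forms
`L_k = Σ_j w_{kj}y_j` and `f_1,…,f_r ∈ F[Y]`, then, substituting `w_{kj} ↦ u_j^{(k)}`,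
there is `e` with `y_{j_0}^e·σ(F_0) ∈ [{f_1,…,f_r} ∪ {P_0} ∪ {y_iy_j′ − y_jy_i′}]` in the
differential polynomial ring `F{y_0,…,y_n; u_0,…,u_n}`. -/
theorem stmt_13 (F : Type*) [Field F] [CharZero F]
    (dF : Derivation ℤ F F)
    (n d r : ℕ)
    (δ : Derivation ℤ (MvPolynomial ((Fin (n + 1) ⊕ Fin (n + 1)) × ℕ) F)
      (MvPolynomial ((Fin (n + 1) ⊕ Fin (n + 1)) × ℕ) F))
    (hδC : ∀ a : F, δ (C a) = C (dF a))
    (hδX : ∀ (v : Fin (n + 1) ⊕ Fin (n + 1)) (k : ℕ), δ (X (v, k)) = X (v, k + 1))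
    (fy : Fin r → MvPolynomial (Fin (n + 1)) F)
    (L : Fin (d + 1) → MvPolynomial (Fin (d + 1) × Fin (n + 1) ⊕ Fin (n + 1)) F)
    (hL : ∀ k, L k = ∑ j : Fin (n + 1), X (Sum.inl (k, j)) * X (Sum.inr j))
    (F₀ : MvPolynomial (Fin (d + 1) × Fin (n + 1)) F)
    (j₀ : Fin (n + 1)) (a : ℕ)
    (hmem : X ((Sum.inr j₀ : Fin (d + 1) × Fin (n + 1) ⊕ Fin (n + 1))) ^ a *
        rename Sum.inl F₀ ∈
      Ideal.span (Set.range L ∪ Set.range fun i => rename Sum.inr (fy i)))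
    (σF₀ : MvPolynomial ((Fin (n + 1) ⊕ Fin (n + 1)) × ℕ) F)
    (hσF₀ : σF₀ = aeval (fun q : Fin (d + 1) × Fin (n + 1) =>
      X ((Sum.inr q.2 : Fin (n + 1) ⊕ Fin (n + 1)), (q.1 : ℕ))) F₀)
    (P₀ : MvPolynomial ((Fin (n + 1) ⊕ Fin (n + 1)) × ℕ) F)
    (hP₀ : P₀ = ∑ j : Fin (n + 1),
      X ((Sum.inr j : Fin (n + 1) ⊕ Fin (n + 1)), 0) *
        X ((Sum.inl j : Fin (n + 1) ⊕ Fin (n + 1)), 0))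
    (Gset : Set (MvPolynomial ((Fin (n + 1) ⊕ Fin (n + 1)) × ℕ) F))
    (hGset : Gset = {g | ∃ i j : Fin (n + 1), i < j ∧
      g = X ((Sum.inl i : Fin (n + 1) ⊕ Fin (n + 1)), 0) *
            X ((Sum.inl j : Fin (n + 1) ⊕ Fin (n + 1)), 1) -
          X ((Sum.inl j : Fin (n + 1) ⊕ Fin (n + 1)), 0) *
            X ((Sum.inl i : Fin (n + 1) ⊕ Fin (n + 1)), 1)}) :
    ∃ e : ℕ,
      X ((Sum.inl j₀ : Fin (n + 1) ⊕ Fin (n + 1)), 0) ^ e * σF₀ ∈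
        diffIdealGen (⇑δ)
          ((Set.range fun i =>
              aeval (fun j : Fin (n + 1) =>
                X ((Sum.inl j : Fin (n + 1) ⊕ Fin (n + 1)), 0)) (fy i)) ∪
            {P₀} ∪ Gset) := by
  subst hσF₀ hP₀ hGset
  generalize hS : ((Set.range fun i => aeval (fun j : Fin (n + 1) =>
    (X ((Sum.inl j : Fin (n + 1) ⊕ Fin (n + 1)), 0) :
      MvPolynomial ((Fin (n + 1) ⊕ Fin (n + 1)) × ℕ) F)) (fy i)) ∪ _ ∪ _) = S
  set y : Fin (n + 1) → MvPolynomial ((Fin (n + 1) ⊕ Fin (n + 1)) × ℕ) F :=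
    fun j => X (Sum.inl j, 0) with hy
  set u : Fin (n + 1) → ℕ → MvPolynomial ((Fin (n + 1) ⊕ Fin (n + 1)) × ℕ) F :=
    fun j k => X (Sum.inr j, k) with hu
  have hsub := subset_diffIdealGen δ S
  have hG : ∀ i j, i < j → y i * δ (y j) - y j * δ (y i) ∈ diffIdealGen δ S := fun i j hij =>
    hsub (by rw [← hS]; exact Or.inr ⟨i, j, hij, by simp only [hy, hδX, zero_add]⟩)
  have hW : ∀ j, y j₀ * δ (y j) - y j * δ (y j₀) ∈ diffIdealGen δ S := by
    intro j
    rcases lt_trichotomy j₀ j with h | rfl | h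
    · exact hG _ _ h
    · simp
    · simpa using neg_mem (hG _ _ h)
  have hP : ∑ j, u j 0 * y j ∈ diffIdealGen δ S :=
    hsub (by rw [← hS]; exact Or.inl (Or.inr rfl))
  have hQ := pow_mul_sum_mem_of_wronskian_mem δ (diffIdealGen δ S)
    (fun x hx => map_mem_diffIdealGen δ hx) y u (fun j k => hδX _ k) hP j₀ hW
  let φ : MvPolynomial (Fin (d + 1) × Fin (n + 1) ⊕ Fin (n + 1)) F →ₐ[F]
      MvPolynomial ((Fin (n + 1) ⊕ Fin (n + 1)) × ℕ) F :=
    aeval (Sum.elim (fun q => u q.2 q.1) y)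
  have hφ : ∀ g ∈ Ideal.span (Set.range L ∪ Set.range fun i => rename Sum.inr (fy i)),
      y j₀ ^ d * φ g ∈ diffIdealGen δ S := by
    intro g hg
    induction hg using Submodule.span_induction with
    | mem g hg =>
      rcases hg with ⟨k, rfl⟩ | ⟨i, rfl⟩
      · have hφL : φ (L k) = ∑ j, u j k * y j := by simp [φ, hL]
        rw [hφL, ← pow_sub_mul_pow _ (Nat.le_of_lt_succ k.2), mul_assoc]
        exact Ideal.mul_mem_left _ _ (hQ k)
      · refine Ideal.mul_mem_left _ _ (hsub ?_)
        rw [← hS]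
        exact Or.inl (Or.inl ⟨i, by simp only [φ, aeval_rename, Sum.elim_comp_inr]⟩)
    | zero => simp
    | add g h _ _ hg hh => rw [map_add, mul_add]; exact add_mem hg hh
    | smul c g _ hg =>
      rw [smul_eq_mul, map_mul, mul_left_comm]
      exact Ideal.mul_mem_left _ _ hg
  refine ⟨d + a, ?_⟩
  have h := hφ _ hmem
  rw [map_mul, map_pow, aeval_X, aeval_rename, ← mul_assoc, Sum.elim_inr, Sum.elim_comp_inl,
    ← pow_add] at h
  exact h
end
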